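/- Let u be a distribution on ℂ with compact support such that ∂u/∂z̄ = 0 on ℂ ∖ K for a compact set K, i.e., u is holomorphic on ℂ ∖ K. If ℂ ∖ K is connected, then the support of u is contained in K. -/

import Mathlib

open SchwartzMap
open scoped ContDiff Topology LineDeriv

theorem aux_taylor0 {E : Type} [NormedAddCommGroup E] [NormedSpace ℝ E] (F : ℂ → E)
    (hF : ContDiff ℝ ∞ F) (hc : HasCompactSupport F) :
    ∃ C : ℝ, 0 ≤ C ∧ ∀ h x : ℂ, ‖F (x - h) - F x + fderiv ℝ F x h‖ ≤ C * ‖h‖ ^ 2 := by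
  obtain ⟨C, hC⟩ := ContDiff.lipschitzWith_of_hasCompactSupport (𝕂 := ℝ) (n := ∞)
    (hc.fderiv ℝ) (hF.fderiv_right (m := ∞) (by simp)) (by simp)
  refine ⟨C, C.2, fun h x => ?_⟩
  have := (convex_closedBall x ‖h‖).norm_image_sub_le_of_norm_hasFDerivWithin_le'
    (f := F) (f' := fderiv ℝ F) (φ := fderiv ℝ F x) (C := C * ‖h‖) (x := x) (y := x - h)
    (fun y _ => ((hF.differentiable (by simp)) y).hasFDerivAt.hasFDerivWithinAt)
    (fun y hy => by
      rw [← dist_eq_norm]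
      refine (hC.dist_le_mul y x).trans ?_
      gcongr
      exact hy) (by simp) (by simp)
  simp only [sub_sub_cancel_left, map_neg, sub_neg_eq_add, norm_neg] at this
  linarith [this]

theorem aux_taylor (n : ℕ) : ∀ {E : Type} [NormedAddCommGroup E] [NormedSpace ℝ E] (F : ℂ → E)
    (_ : ContDiff ℝ ∞ F) (_ : HasCompactSupport F),
    ∃ C : ℝ, 0 ≤ C ∧ ∀ h x : ℂ,
      ‖iteratedFDeriv ℝ n (fun x => F (x - h) - F x + fderiv ℝ F x h) x‖ ≤ C * ‖h‖ ^ 2 := by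
  induction n with
  | zero =>
    intro E _ _ F hF hc
    simpa using aux_taylor0 F hF hc
  | succ n ih =>
    intro E _ _ F hF hc
    have hF' : ContDiff ℝ ∞ (fderiv ℝ F) := hF.fderiv_right (m := ∞) (by simp)
    obtain ⟨C, hC0, hC⟩ := ih (fderiv ℝ F) hF' (hc.fderiv ℝ)
    refine ⟨C, hC0, fun h x => ?_⟩
    rw [← norm_iteratedFDeriv_fderiv]
    suffices e : fderiv ℝ (fun x => F (x - h) - F x + fderiv ℝ F x h) =
        fun x => fderiv ℝ F (x - h) - fderiv ℝ F x + fderiv ℝ (fderiv ℝ F) x h by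
      rw [e]
      exact hC h x
    funext y
    have d1 : ∀ z, HasFDerivAt F (fderiv ℝ F z) z := fun z =>
      ((hF.differentiable (by simp)) z).hasFDerivAt
    have d2 : HasFDerivAt (fderiv ℝ F) (fderiv ℝ (fderiv ℝ F) y) y :=
      ((hF'.differentiable (by simp)) y).hasFDerivAt
    have d3 : HasFDerivAt (fun x => F (x - h)) (fderiv ℝ F (y - h)) y := by
      have := (d1 (y - h)).comp y ((hasFDerivAt_id y).sub_const h)
      exact this
    have d4 := d2.clm_apply (hasFDerivAt_const h y)
    refine ((d3.sub (d1 y)).add d4).fderiv.trans ?_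
    congr 1
    ext1 v
    have hs : IsSymmSndFDerivAt ℝ F y := hF.contDiffAt.isSymmSndFDerivAt (by simp; exact WithTop.coe_le_coe.2 le_top)
    simpa using hs v h

theorem aux_seminorm (φ : 𝓢(ℂ, ℂ)) (hc : HasCompactSupport φ) (k n : ℕ) :
    ∃ C : ℝ, 0 ≤ C ∧ ∀ h : ℂ, ‖h‖ ≤ 1 →
      SchwartzMap.seminorm ℂ k n (compSubConstCLM ℂ h φ - φ + ∂_{h} φ) ≤ C * ‖h‖ ^ 2 := by
  obtain ⟨C, hC0, hC⟩ := aux_taylor n (⇑φ) (φ.smooth ⊤) hc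
  obtain ⟨R, hR⟩ := hc.isCompact.isBounded.exists_norm_le
  set R' := |R| + 1
  refine ⟨R' ^ k * C, by positivity, fun h hh => ?_⟩
  refine SchwartzMap.seminorm_le_bound ℂ k n _ (by positivity) fun x => ?_
  have e : (⇑(compSubConstCLM ℂ h φ - φ + ∂_{h} φ) : ℂ → ℂ)
      = fun x => φ (x - h) - φ x + fderiv ℝ (⇑φ) x h := by
    ext x
    simp [lineDerivOp_apply_eq_fderiv]
  rw [e]
  by_cases hx : ‖x‖ ≤ R'
  · rw [mul_assoc]
    gcongr
    exact hC h x
  · have hx : R' < ‖x‖ := not_le.1 hx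
    have : x ∉ tsupport (fun x => φ (x - h) - φ x + fderiv ℝ (⇑φ) x h) := by
      intro hmem
      have : tsupport (fun x => φ (x - h) - φ x + fderiv ℝ (⇑φ) x h) ⊆ Metric.closedBall 0 R' := by
        refine closure_minimal (fun y hy => ?_) Metric.isClosed_closedBall
        by_contra hy'
        have hy' : R' < ‖y‖ := by simpa using hy'
        have a1 : y ∉ tsupport φ := fun hm => by
          have := hR y hm
          have := le_abs_self R
          simp only [R'] at hy'
          linarith
        have a2 : y - h ∉ tsupport φ := fun hm => by
          have := hR _ hm
          have := le_abs_self R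
          have := norm_sub_norm_le y h
          simp only [R'] at hy'
          linarith
        have a3 : fderiv ℝ φ y = 0 := by
          by_contra h3
          exact a1 (support_fderiv_subset ℝ h3)
        apply hy
        simp [image_eq_zero_of_notMem_tsupport a1, image_eq_zero_of_notMem_tsupport a2, a3]
      have := this hmem
      simp at this
      linarith
    have h0 : iteratedFDeriv ℝ n (fun x => φ (x - h) - φ x + fderiv ℝ (⇑φ) x h) x = 0 := by
      by_contra h3
      exact this (support_iteratedFDeriv_subset n h3)
    rw [h0]
    simp only [norm_zero, mul_zero]
    positivity

theorem aux_tendsto (φ : 𝓢(ℂ, ℂ)) (hc : HasCompactSupport φ) :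
    Filter.Tendsto (fun h : ℂ => ((‖h‖⁻¹ : ℝ) : ℂ) • (compSubConstCLM ℂ h φ - φ + ∂_{h} φ))
      (𝓝 0) (𝓝 0) := by
  rw [(schwartz_withSeminorms ℂ ℂ ℂ).tendsto_nhds]
  rintro ⟨k, n⟩ ε hε
  obtain ⟨C, hC0, hC⟩ := aux_seminorm φ hc k n
  have hδ : 0 < min 1 (ε / (C + 1)) := by positivity
  filter_upwards [Metric.ball_mem_nhds (0 : ℂ) hδ] with h hh
  have hh' : ‖h‖ < min 1 (ε / (C + 1)) := by simpa using hh
  have h1 := hC h (hh'.le.trans (min_le_left _ _))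
  have h2 := (lt_div_iff₀ (by positivity)).1 (hh'.trans_le (min_le_right _ _))
  rw [sub_zero, map_smul_eq_mul, schwartzSeminormFamily_apply]
  have h3 : ‖((‖h‖⁻¹ : ℝ) : ℂ)‖ = ‖h‖⁻¹ := by simp
  rw [h3]
  rcases eq_or_ne h 0 with rfl | hne
  · simpa using hε
  have : 0 < ‖h‖ := norm_pos_iff.2 hne
  calc _ ≤ ‖h‖⁻¹ * (C * ‖h‖ ^ 2) := by gcongr
    _ = C * ‖h‖ := by field_simp
    _ < ε := by nlinarith

theorem aux_hasDerivAt (u : 𝓢(ℂ, ℂ) →L[ℂ] ℂ) (φ : 𝓢(ℂ, ℂ)) (hc : HasCompactSupport φ)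
    (hd : ∀ h : ℂ, u (∂_{h} φ) = h * u (∂_{(1 : ℂ)} φ)) :
    HasDerivAt (fun w : ℂ => u (compSubConstCLM ℂ w φ)) (- u (∂_{(1 : ℂ)} φ)) 0 := by
  rw [hasDerivAt_iff_tendsto]
  have := ((u.continuous.tendsto 0).comp (aux_tendsto φ hc)).norm
  simp only [map_zero, norm_zero] at this
  refine this.congr fun h => ?_
  simp only [Function.comp, map_smul, map_add, map_sub, hd h, norm_smul, sub_zero,
    compSubConstCLM_zero]
  simp

theorem aux_hd (K : Set ℂ) (u : 𝓢(ℂ, ℂ) →L[ℂ] ℂ)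
    (hdbar : ∀ φ ψ : 𝓢(ℂ, ℂ), HasCompactSupport (⇑φ) → tsupport (⇑φ) ⊆ Kᶜ →
      (∀ z : ℂ, ψ z = (1 / 2) * (fderiv ℝ (⇑φ) z 1 + Complex.I * fderiv ℝ (⇑φ) z Complex.I)) →
      u ψ = 0) (φ : 𝓢(ℂ, ℂ)) (hc : HasCompactSupport φ) (hs : tsupport φ ⊆ Kᶜ) (h : ℂ) :
    u (∂_{h} φ) = h * u (∂_{(1 : ℂ)} φ) := by
  have h1 := hdbar φ ((1 / 2 : ℂ) • (∂_{(1 : ℂ)} φ + Complex.I • ∂_{Complex.I} φ)) hc hs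
    (fun z => by simp [lineDerivOp_apply_eq_fderiv]; ring)
  have h2 : ∂_{h} φ = (h.re : ℂ) • ∂_{(1 : ℂ)} φ + (h.im : ℂ) • ∂_{Complex.I} φ := by
    ext z
    have : h = h.re • (1 : ℂ) + h.im • Complex.I := by simp
    simp only [lineDerivOp_apply_eq_fderiv, add_apply, smul_apply]
    conv_lhs => rw [this, map_add, map_smul, map_smul]
    simp
  simp only [map_smul, map_add, smul_eq_mul] at h1
  have h3 : u (∂_{Complex.I} φ) = Complex.I * u (∂_{(1 : ℂ)} φ) := by
    linear_combination (-2 * Complex.I) * h1 + u (∂_{Complex.I} φ) * Complex.I_sq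
  rw [h2, map_add, map_smul, map_smul, h3]
  conv_rhs => rw [← Complex.re_add_im h]
  simp only [smul_eq_mul]
  ring

theorem aux_tsupport (φ : 𝓢(ℂ, ℂ)) (w a : ℂ) (r : ℝ) (hs : tsupport φ ⊆ Metric.closedBall a r) :
    tsupport (compSubConstCLM ℂ w φ) ⊆ Metric.closedBall (a + w) r := by
  refine closure_minimal (fun y hy => ?_) Metric.isClosed_closedBall
  have : y - w ∈ tsupport φ := subset_tsupport _ (by simpa using hy)
  have := hs this
  simp only [Metric.mem_closedBall, dist_eq_norm] at this ⊢
  convert this using 2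
  ring

theorem aux_step (K : Set ℂ) (u : 𝓢(ℂ, ℂ) →L[ℂ] ℂ)
    (hdbar : ∀ φ ψ : 𝓢(ℂ, ℂ), HasCompactSupport (⇑φ) → tsupport (⇑φ) ⊆ Kᶜ →
      (∀ z : ℂ, ψ z = (1 / 2) * (fderiv ℝ (⇑φ) z 1 + Complex.I * fderiv ℝ (⇑φ) z Complex.I)) →
      u ψ = 0) (p q : ℂ) (r s : ℝ) (hs0 : 0 < s) (hsr : s ≤ r)
    (hp : Metric.ball p (4 * r) ⊆ Kᶜ) (hq : dist q p < r)
    (hu : ∀ φ : 𝓢(ℂ, ℂ), tsupport φ ⊆ Metric.closedBall q s → u φ = 0)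
    (φ : 𝓢(ℂ, ℂ)) (hφ : tsupport φ ⊆ Metric.closedBall p (s / 2)) : u φ = 0 := by
  have cpt : ∀ (ψ : 𝓢(ℂ, ℂ)) (a : ℂ) (t : ℝ), tsupport ψ ⊆ Metric.closedBall a t →
      HasCompactSupport ψ := fun ψ a t h =>
    (isCompact_closedBall a t).of_isClosed_subset (isClosed_tsupport _) h
  have hdiff : DifferentiableOn ℂ (fun w : ℂ => u (compSubConstCLM ℂ w φ))
      (Metric.ball 0 (2 * r)) := by
    intro w hw
    have hw : ‖w‖ < 2 * r := by simpa using hw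
    have hsupp := aux_tsupport φ w p _ hφ
    have hsK : tsupport (compSubConstCLM ℂ w φ) ⊆ Kᶜ := by
      refine hsupp.trans (subset_trans ?_ hp)
      refine Metric.closedBall_subset_ball' ?_
      simp [dist_eq_norm]
      linarith
    have hcc := cpt _ _ _ hsupp
    have h1 := aux_hasDerivAt u (compSubConstCLM ℂ w φ) hcc
      (aux_hd K u hdbar _ hcc hsK)
    have h2 : HasDerivAt (fun v : ℂ => u (compSubConstCLM ℂ (v - w) (compSubConstCLM ℂ w φ)))
      (- u (∂_{(1 : ℂ)} (compSubConstCLM ℂ w φ))) w := by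
      have := HasDerivAt.comp_sub_const (f := fun v : ℂ => u (compSubConstCLM ℂ v (compSubConstCLM ℂ w φ)))
        w w (by rw [sub_self]; exact h1)
      exact this
    refine DifferentiableAt.differentiableWithinAt ?_
    have e : (fun w : ℂ => u (compSubConstCLM ℂ w φ)) =
        fun v : ℂ => u (compSubConstCLM ℂ (v - w) (compSubConstCLM ℂ w φ)) := by
      funext v
      congr 1
      ext x
      simp
    rw [e]
    exact h2.differentiableAt
  have h0 := (hdiff.analyticOnNhd Metric.isOpen_ball).eqOn_zero_of_preconnected_of_eventuallyEq_zero
    (convex_ball (0 : ℂ) (2 * r)).isPreconnected (z₀ := q - p)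
    (by simp [← dist_eq_norm]; linarith [dist_nonneg (x := q) (y := p)])
    (by
      filter_upwards [Metric.ball_mem_nhds (q - p) (half_pos hs0)] with w hw
      refine hu _ ((aux_tsupport φ w p _ hφ).trans (Metric.closedBall_subset_closedBall' ?_))
      have e : dist (p + w) q = dist w (q - p) := by
        simp only [dist_eq_norm]; congr 1; ring
      rw [Metric.mem_ball] at hw
      rw [e]; linarith)
  have := h0 (x := 0) (by simp; linarith)
  simpa [compSubConstCLM_zero] using this

theorem aux_glue (u : 𝓢(ℂ, ℂ) →L[ℂ] ℂ) (φ : 𝓢(ℂ, ℂ)) (hc : HasCompactSupport φ)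
    (h : ∀ x ∈ tsupport φ, ∃ r : ℝ, 0 < r ∧
      ∀ ψ : 𝓢(ℂ, ℂ), tsupport ψ ⊆ Metric.closedBall x r → u ψ = 0) : u φ = 0 := by
  choose! r hr hu using h
  obtain ⟨t, htK, ht⟩ := hc.isCompact.elim_nhds_subcover (fun x => Metric.ball x (r x))
    (fun x hx => Metric.ball_mem_nhds x (hr x hx))
  obtain ⟨ρ, hρ⟩ := SmoothPartitionOfUnity.exists_isSubordinate (modelWithCornersSelf ℝ ℂ)
    (isClosed_tsupport φ) (fun i : t => Metric.ball (i : ℂ) (r i)) (fun _ => Metric.isOpen_ball)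
    (by intro x hx; simpa using ht hx)
  have hsm : ∀ i, ContDiff ℝ ∞ (fun x => ((ρ i x : ℝ) : ℂ) * φ x) := fun i =>
    (Complex.ofRealCLM.contDiff.comp (ρ i).contMDiff.contDiff).mul (φ.smooth ⊤)
  have hcs : ∀ i, HasCompactSupport (fun x => ((ρ i x : ℝ) : ℂ) * φ x) := fun i => hc.mul_left
  have hsum : φ = ∑ i, (hcs i).toSchwartzMap (hsm i) := by
    ext x
    rw [sum_apply]
    simp only [HasCompactSupport.toSchwartzMap_toFun]
    rw [← Finset.sum_mul]
    by_cases hx : x ∈ tsupport φ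
    · have := ρ.sum_eq_one hx
      rw [finsum_eq_sum_of_fintype] at this
      rw [← Complex.ofReal_sum, this]
      simp
    · simp [image_eq_zero_of_notMem_tsupport hx]
  rw [hsum, map_sum]
  refine Finset.sum_eq_zero fun i _ => hu i (htK i i.2) _ ?_
  refine subset_trans ?_ ((hρ i).trans Metric.ball_subset_closedBall)
  refine closure_mono fun x hx => ?_
  intro h0
  apply hx
  simp [h0]

theorem stmt_9 (K : Set ℂ) (hK : IsCompact K) (hconn : IsConnected Kᶜ)
    (u : 𝓢(ℂ, ℂ) →L[ℂ] ℂ)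
    -- u has compact support
    (hcpt : ∃ L : Set ℂ, IsCompact L ∧
      ∀ φ : 𝓢(ℂ, ℂ), HasCompactSupport (⇑φ) → tsupport (⇑φ) ⊆ Lᶜ → u φ = 0)
    -- ∂u/∂z̄ = 0 on ℂ ∖ K : u annihilates ∂̄φ for all test functions φ supported in Kᶜ
    (hdbar : ∀ φ ψ : 𝓢(ℂ, ℂ), HasCompactSupport (⇑φ) → tsupport (⇑φ) ⊆ Kᶜ →
      (∀ z : ℂ, ψ z = (1 / 2) * (fderiv ℝ (⇑φ) z 1 + Complex.I * fderiv ℝ (⇑φ) z Complex.I)) →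
      u ψ = 0) :
    -- the support of u is contained in K
    ∀ φ : 𝓢(ℂ, ℂ), HasCompactSupport (⇑φ) → tsupport (⇑φ) ⊆ Kᶜ → u φ = 0 := by
  intro φ hc hs
  obtain ⟨L, hL, hLu⟩ := hcpt
  let W : Set ℂ := {x | ∃ r : ℝ, 0 < r ∧
      ∀ ψ : 𝓢(ℂ, ℂ), tsupport ψ ⊆ Metric.closedBall x r → u ψ = 0}
  have hW : IsOpen W := by
    rw [Metric.isOpen_iff]
    rintro x ⟨r, hr, h⟩
    refine ⟨r / 2, by positivity, fun y hy => ⟨r / 2, by positivity, fun ψ hψ => h ψ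
      (hψ.trans (Metric.closedBall_subset_closedBall' ?_))⟩⟩
    rw [Metric.mem_ball] at hy
    linarith
  have hsub : Kᶜ ⊆ W := by
    refine hconn.isPreconnected.subset_of_closure_inter_subset hW ?_ ?_
    · obtain ⟨x, hx⟩ := (Set.ne_univ_iff_exists_notMem _).1 (hK.union hL).ne_univ
      rw [Set.mem_union, not_or] at hx
      obtain ⟨r, hr, hball⟩ := Metric.nhds_basis_closedBall.mem_iff.1
        (hL.isClosed.isOpen_compl.mem_nhds hx.2)
      exact ⟨x, hx.1, r, hr, fun ψ hψ => hLu ψ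
        ((isCompact_closedBall x r).of_isClosed_subset (isClosed_tsupport _) hψ)
        (hψ.trans hball)⟩
    · rintro p ⟨hp, hpK⟩
      obtain ⟨R, hR, hball⟩ := Metric.isOpen_iff.1 hK.isClosed.isOpen_compl p hpK
      obtain ⟨q, ⟨s, hs, hq⟩, hqp⟩ := Metric.mem_closure_iff.1 hp (R / 4) (by positivity)
      refine ⟨min s (R / 4) / 2, by positivity, fun ψ hψ => ?_⟩
      refine aux_step K u hdbar p q (R / 4) (min s (R / 4)) (by positivity) (min_le_right _ _)
        (by convert hball using 2; ring) (by rwa [dist_comm]) (fun χ hχ => hq χ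
          (hχ.trans (Metric.closedBall_subset_closedBall (min_le_left _ _)))) ψ hψ
  exact aux_glue u φ hc fun x hx => hsub (hs hx)
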